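/- arXiv:2405.07961 — 2 statements merged into one kernel-verified Lean document; each statement's English description precedes it below -/
import Mathlib

section
/- Assume the graph with node set ∂Ω ∪ Ω⁻ and edges {x,y} with σ⁻(x,y) > 0 is connected. Then the Neumann–Poincaré operator D' has eigenvalue −1/2, and the corresponding eigenspace, i.e. the kernel of D' + I/2, is the one-dimensional span of S⁻¹𝟙, where 𝟙 ∈ ℝ^{∂Ω} is the all-ones vector. -/
open Matrix BigOperators

noncomputable section

variable {V : Type*} [Fintype V] [DecidableEq V]

/-- Weighted graph Laplacian of a symmetric weight function. -/
def lap (σ : V → V → ℝ) : Matrix V V ℝ :=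
  Matrix.of fun x y => if x = y then ∑ z, σ x z else -σ x y

/-- Restriction matrix `R_X : ℝ^V → ℝ^X`. -/
def restr (X : Finset V) : Matrix {x // x ∈ X} V ℝ :=
  Matrix.of fun i j => if (i : V) = j then 1 else 0

/-- Green function `G = R_{V°}ᵀ (L[V°,V°])⁻¹ R_{V°}` with `V° = Bᶜ`. -/
def green (B : Finset V) (σ : V → V → ℝ) : Matrix V V ℝ :=
  (restr Bᶜ)ᵀ * (restr Bᶜ * lap σ * (restr Bᶜ)ᵀ)⁻¹ * restr Bᶜ

/-- Dirichlet trace operator `γ₀ = R_{∂Ω}`. -/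
def gamma0 (dO : Finset V) : Matrix {x // x ∈ dO} V ℝ := restr dO

/-- Exterior Neumann trace operator `γ₁⁺ = -R_{∂Ω} L(σ⁺)`. -/
def gamma1p (dO : Finset V) (σp : V → V → ℝ) : Matrix {x // x ∈ dO} V ℝ :=
  -(restr dO * lap σp)

/-- Interior Neumann trace operator `γ₁⁻ = R_{∂Ω} L(σ⁻)`. -/
def gamma1m (dO : Finset V) (σm : V → V → ℝ) : Matrix {x // x ∈ dO} V ℝ :=
  restr dO * lap σm

/-- Single layer potential `𝒮 = G γ₀ᵀ`. -/
def slp (B dO : Finset V) (σ : V → V → ℝ) : Matrix V {x // x ∈ dO} ℝ :=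
  green B σ * (gamma0 dO)ᵀ

/-- Exterior double layer potential `𝒟⁺ = G (γ₁⁺)ᵀ`. -/
def dlpP (B dO : Finset V) (σ σp : V → V → ℝ) : Matrix V {x // x ∈ dO} ℝ :=
  green B σ * (gamma1p dO σp)ᵀ

/-- Interior double layer potential `𝒟⁻ = G (γ₁⁻)ᵀ`. -/
def dlpM (B dO : Finset V) (σ σm : V → V → ℝ) : Matrix V {x // x ∈ dO} ℝ :=
  green B σ * (gamma1m dO σm)ᵀ

/-- Single layer boundary operator `S = γ₀ 𝒮`. -/
def Sop (B dO : Finset V) (σ : V → V → ℝ) : Matrix {x // x ∈ dO} {x // x ∈ dO} ℝ :=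
  gamma0 dO * slp B dO σ

/-- Double layer boundary operator `D = ½ γ₀ (𝒟⁺ + 𝒟⁻)`. -/
def Dop (B dO : Finset V) (σ σp σm : V → V → ℝ) : Matrix {x // x ∈ dO} {x // x ∈ dO} ℝ :=
  (1/2 : ℝ) • (gamma0 dO * (dlpP B dO σ σp + dlpM B dO σ σm))

/-- Adjoint double layer (Neumann–Poincaré) operator `D' = ½ (γ₁⁺ + γ₁⁻) 𝒮`. -/
def Dadj (B dO : Finset V) (σ σp σm : V → V → ℝ) : Matrix {x // x ∈ dO} {x // x ∈ dO} ℝ :=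
  (1/2 : ℝ) • ((gamma1p dO σp + gamma1m dO σm) * slp B dO σ)

/-- Hypersingular operator `H = -γ₁⁺ 𝒟⁻`. -/
def Hop (B dO : Finset V) (σ σp σm : V → V → ℝ) : Matrix {x // x ∈ dO} {x // x ∈ dO} ℝ :=
  -(gamma1p dO σp * dlpM B dO σ σm)

/-- Indicator vector of a node subset. -/
def ind (X : Finset V) : V → ℝ := fun x => if x ∈ X then 1 else 0

/-- The subgraph with node set `A` and edges `{x,y}` with `w x y > 0` is connected. -/
def connOn (A : Finset V) (w : V → V → ℝ) : Prop :=
  ∀ x ∈ A, ∀ y ∈ A, Relation.ReflTransGen (fun a b => a ∈ A ∧ b ∈ A ∧ 0 < w a b) x y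

lemma lap_mulVec {V : Type*} [Fintype V] [DecidableEq V] {w : V → V → ℝ}
    (hdiag : ∀ x, w x x = 0) (v : V → ℝ) (x : V) :
    (lap w *ᵥ v) x = ∑ y, w x y * (v x - v y) := by
  have h : ∀ y, lap w x y * v y = (if x = y then (∑ z, w x z) * v x else 0) - w x y * v y := by
    intro y
    by_cases hxy : x = y
    · subst hxy
      simp [lap, hdiag]
    · simp [lap, hxy]
  simp only [mulVec, dotProduct, h, Finset.sum_sub_distrib, mul_sub, Finset.sum_ite_eq,
    Finset.mem_univ, if_true, Finset.sum_mul]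

lemma lap_add {V : Type*} [Fintype V] [DecidableEq V] {w₁ w₂ w : V → V → ℝ}
    (h : ∀ x y, w₁ x y + w₂ x y = w x y) : lap w₁ + lap w₂ = lap w := by
  ext x y
  by_cases hxy : x = y
  · simp [lap, hxy, ← h, Finset.sum_add_distrib]
  · simp [lap, hxy, ← h]
    ring

lemma restr_mulVec {V : Type*} [Fintype V] [DecidableEq V] (X : Finset V) (v : V → ℝ)
    (x : {x // x ∈ X}) : (restr X *ᵥ v) x = v x := by
  simp [restr, mulVec, dotProduct]

lemma restr_transpose_mulVec {V : Type*} [Fintype V] [DecidableEq V] (X : Finset V)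
    (φ : {x // x ∈ X} → ℝ) (y : V) :
    ((restr X)ᵀ *ᵥ φ) y = if h : y ∈ X then φ ⟨y, h⟩ else 0 := by
  simp only [restr, mulVec, dotProduct, transpose_apply, of_apply, ite_mul, one_mul, zero_mul]
  split_ifs with h
  · rw [Finset.sum_eq_single ⟨y, h⟩]
    · simp
    · intro b _ hb
      rw [if_neg]
      exact fun e => hb (Subtype.ext e)
    · simp
  · refine Finset.sum_eq_zero fun b _ => if_neg ?_
    exact fun e => h (e ▸ b.2)

/-- A vector of vanishing Dirichlet energy takes the same value at both ends of every edge. -/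
lemma eq_of_energy_eq_zero {V : Type*} [Fintype V] [DecidableEq V] {w : V → V → ℝ}
    (hsymm : ∀ x y, w x y = w y x) (hdiag : ∀ x, w x x = 0) (hnn : ∀ x y, 0 ≤ w x y)
    {v : V → ℝ} (h : ∀ x, v x * (lap w *ᵥ v) x = 0) {x y : V} (hxy : 0 < w x y) :
    v x = v y := by
  have h1 : ∑ x, ∑ y, w x y * (v x * (v x - v y)) = 0 := by
    refine Finset.sum_eq_zero fun x _ => ?_
    rw [← h x, lap_mulVec hdiag, Finset.mul_sum]
    exact Finset.sum_congr rfl fun y _ => by ring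
  have h2 : ∑ x, ∑ y, w x y * (v y * (v y - v x)) = 0 := by
    rw [Finset.sum_comm, ← h1]
    exact Finset.sum_congr rfl fun x _ => Finset.sum_congr rfl fun y _ => by rw [hsymm]
  have h3 : ∑ x, ∑ y, w x y * (v x - v y) ^ 2 = 0 := by
    rw [← add_zero (0 : ℝ)]
    nth_rewrite 1 [← h1]
    rw [← h2]
    simp only [← Finset.sum_add_distrib]
    exact Finset.sum_congr rfl fun x _ => Finset.sum_congr rfl fun y _ => by ring
  have hnn' : ∀ x y, 0 ≤ w x y * (v x - v y) ^ 2 := fun x y =>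
    mul_nonneg (hnn x y) (sq_nonneg _)
  have h4 := (Finset.sum_eq_zero_iff_of_nonneg
    fun x _ => Finset.sum_nonneg fun y _ => hnn' x y).1 h3 x (Finset.mem_univ x)
  have h5 := (Finset.sum_eq_zero_iff_of_nonneg fun y _ => hnn' x y).1 h4 y (Finset.mem_univ y)
  rcases mul_eq_zero.1 h5 with h6 | h6
  · exact absurd h6 hxy.ne'
  · exact sub_eq_zero.1 (pow_eq_zero_iff two_ne_zero |>.1 h6)

lemma connOn.eq_of_energy_eq_zero {V : Type*} [Fintype V] [DecidableEq V] {A : Finset V}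
    {w : V → V → ℝ} (hconn : connOn A w)
    (hsymm : ∀ x y, w x y = w y x) (hdiag : ∀ x, w x x = 0) (hnn : ∀ x y, 0 ≤ w x y)
    {v : V → ℝ} (h : ∀ x, v x * (lap w *ᵥ v) x = 0) {x y : V} (hx : x ∈ A) (hy : y ∈ A) :
    v x = v y := by
  induction hconn x hx y hy with
  | refl => rfl
  | tail _ hbc ih =>
    exact (ih hbc.1).trans (_root_.eq_of_energy_eq_zero hsymm hdiag hnn h hbc.2.2)

lemma lap_slp_mulVec {V : Type*} [Fintype V] [DecidableEq V] {B dO : Finset V} {σ : V → V → ℝ}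
    (hpd : (restr Bᶜ * lap σ * (restr Bᶜ)ᵀ).PosDef) (φ : {x // x ∈ dO} → ℝ) {x : V}
    (hx : x ∉ B) :
    (lap σ *ᵥ (slp B dO σ *ᵥ φ)) x = if h : x ∈ dO then φ ⟨x, h⟩ else 0 := by
  have hdet := (Matrix.isUnit_iff_isUnit_det _).1 hpd.isUnit
  have key : restr Bᶜ * (lap σ * slp B dO σ) = restr Bᶜ * (restr dO)ᵀ := by
    calc restr Bᶜ * (lap σ * slp B dO σ)
        = (restr Bᶜ * lap σ * (restr Bᶜ)ᵀ) * (restr Bᶜ * lap σ * (restr Bᶜ)ᵀ)⁻¹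
            * (restr Bᶜ * (restr dO)ᵀ) := by
          simp only [slp, green, gamma0, Matrix.mul_assoc]
      _ = restr Bᶜ * (restr dO)ᵀ := by rw [Matrix.mul_nonsing_inv _ hdet, Matrix.one_mul]
  have h := congrFun (congrArg (· *ᵥ φ) key) ⟨x, Finset.mem_compl.2 hx⟩
  simp only [← mulVec_mulVec] at h
  rw [restr_mulVec, restr_mulVec, restr_transpose_mulVec] at h
  exact h

lemma Sop_mulVec {V : Type*} [Fintype V] [DecidableEq V] (B dO : Finset V) (σ : V → V → ℝ)
    (φ : {x // x ∈ dO} → ℝ) (x : {x // x ∈ dO}) :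
    (Sop B dO σ *ᵥ φ) x = (slp B dO σ *ᵥ φ) x := by
  rw [Sop, gamma0, ← mulVec_mulVec, restr_mulVec]

lemma posDef_Sop {V : Type*} [Fintype V] [DecidableEq V] {B dO : Finset V} {σ : V → V → ℝ}
    (hd : Disjoint B dO) (hpd : (restr Bᶜ * lap σ * (restr Bᶜ)ᵀ).PosDef) :
    (Sop B dO σ).PosDef := by
  have hinj : Function.Injective (restr Bᶜ * (restr dO)ᵀ).mulVec := by
    intro φ ψ h
    ext x
    have hx : (x : V) ∈ Bᶜ := Finset.mem_compl.2 fun hB => Finset.disjoint_left.1 hd hB x.2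
    have h' := congrFun h ⟨x, hx⟩
    simpa only [← mulVec_mulVec, restr_mulVec, restr_transpose_mulVec, x.2, dif_pos] using h'
  have h := hpd.inv.conjTranspose_mul_mul_same hinj
  rw [conjTranspose_eq_transpose_of_trivial, transpose_mul, transpose_transpose] at h
  simpa only [Sop, slp, green, gamma0, Matrix.mul_assoc] using h

lemma Dadj_mulVec {V : Type*} [Fintype V] [DecidableEq V] {B dO : Finset V}
    {σ σp σm : V → V → ℝ} (hd : Disjoint B dO) (hsum : ∀ x y, σp x y + σm x y = σ x y)
    (hpd : (restr Bᶜ * lap σ * (restr Bᶜ)ᵀ).PosDef) (φ : {x // x ∈ dO} → ℝ)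
    (x : {x // x ∈ dO}) :
    (Dadj B dO σ σp σm *ᵥ φ) x = (lap σm *ᵥ (slp B dO σ *ᵥ φ)) x - 1 / 2 * φ x := by
  have h := lap_slp_mulVec hpd φ (fun hB => Finset.disjoint_left.1 hd hB x.2)
  rw [dif_pos x.2, ← lap_add hsum, add_mulVec, Pi.add_apply] at h
  rw [Dadj, gamma1p, gamma1m, smul_mulVec, ← mulVec_mulVec, add_mulVec, neg_mulVec,
    ← mulVec_mulVec, ← mulVec_mulVec, Pi.smul_apply, Pi.add_apply, Pi.neg_apply, restr_mulVec,
    restr_mulVec, smul_eq_mul]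
  linarith

theorem stmt_15
    {V : Type*} [Fintype V] [DecidableEq V]
    (B Op dO Om : Finset V)
    (hBne : B.Nonempty) (hOpne : Op.Nonempty) (hdOne : dO.Nonempty) (hOmne : Om.Nonempty)
    (hd1 : Disjoint B Op) (hd2 : Disjoint B dO) (hd3 : Disjoint B Om)
    (hd4 : Disjoint Op dO) (hd5 : Disjoint Op Om) (hd6 : Disjoint dO Om)
    (hcover : B ∪ Op ∪ dO ∪ Om = Finset.univ)
    (σ σp σm : V → V → ℝ)
    (hσsymm : ∀ x y, σ x y = σ y x) (hσdiag : ∀ x, σ x x = 0)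
    (hσnn : ∀ x y, 0 ≤ σ x y)
    (hsepBdO : ∀ x ∈ B, ∀ y ∈ dO, σ x y = 0)
    (hsepBOm : ∀ x ∈ B, ∀ y ∈ Om, σ x y = 0)
    (hsepOpOm : ∀ x ∈ Op, ∀ y ∈ Om, σ x y = 0)
    (hσpsymm : ∀ x y, σp x y = σp y x) (hσpdiag : ∀ x, σp x x = 0)
    (hσmsymm : ∀ x y, σm x y = σm y x) (hσmdiag : ∀ x, σm x x = 0)
    (hσpnn : ∀ x y, 0 ≤ σp x y) (hσmnn : ∀ x y, 0 ≤ σm x y)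
    (hsum : ∀ x y, σp x y + σm x y = σ x y)
    (hp1 : ∀ x y, x ∈ B ∪ Op ∨ y ∈ B ∪ Op → σp x y = σ x y)
    (hm1 : ∀ x y, x ∈ Om ∨ y ∈ Om → σm x y = σ x y)
    (hpd : (restr Bᶜ * lap σ * (restr Bᶜ)ᵀ).PosDef)
    (hconn : connOn (dO ∪ Om) σm) :
    (∀ φ : {x // x ∈ dO} → ℝ,
        Dadj B dO σ σp σm *ᵥ φ = (-(1/2) : ℝ) • φ
        ↔ ∃ c : ℝ, φ = c • ((Sop B dO σ)⁻¹ *ᵥ (fun _ => (1 : ℝ))))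
    ∧ (Sop B dO σ)⁻¹ *ᵥ (fun _ => (1 : ℝ)) ≠ 0 := by
  have hm0 : ∀ x y, x ∈ B ∪ Op → σm x y = 0 := fun x y hx => by
    linarith [hsum x y, hp1 x y (Or.inl hx)]
  have hmem : ∀ x, x ∈ B ∪ Op ∨ x ∈ dO ∨ x ∈ Om := fun x => by
    have := Finset.mem_univ x
    rw [← hcover] at this
    simpa only [Finset.mem_union, or_assoc] using this
  have hout : ∀ v x, x ∈ B ∪ Op → (lap σm *ᵥ v) x = 0 := fun v x hx => by
    rw [lap_mulVec hσmdiag]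
    exact Finset.sum_eq_zero fun y _ => by rw [hm0 x y hx, zero_mul]
  have hin : ∀ φ : {x // x ∈ dO} → ℝ, ∀ x ∈ Om, (lap σm *ᵥ (slp B dO σ *ᵥ φ)) x = 0 := by
    intro φ x hx
    have h := lap_slp_mulVec hpd φ fun hB => Finset.disjoint_left.1 hd3 hB hx
    rw [dif_neg fun hO => Finset.disjoint_left.1 hd6 hO hx, lap_mulVec hσdiag] at h
    rw [lap_mulVec hσmdiag, ← h]
    exact Finset.sum_congr rfl fun y _ => by rw [hm1 x y (Or.inl hx)]
  have hS := (Matrix.isUnit_iff_isUnit_det _).1 (posDef_Sop hd2 hpd).isUnit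
  have hSinv : Sop B dO σ *ᵥ ((Sop B dO σ)⁻¹ *ᵥ fun _ => (1 : ℝ)) = fun _ => 1 := by
    rw [mulVec_mulVec, Matrix.mul_nonsing_inv _ hS, one_mulVec]
  obtain ⟨x₀, hx₀⟩ := hdOne
  refine ⟨fun φ => ⟨fun h => ?_, ?_⟩, fun h => ?_⟩
  · have hbd : ∀ x ∈ dO, (lap σm *ᵥ (slp B dO σ *ᵥ φ)) x = 0 := fun x hx => by
      have h1 := congrFun h ⟨x, hx⟩
      rw [Dadj_mulVec hd2 hsum hpd, Pi.smul_apply, smul_eq_mul] at h1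
      linarith
    have hconst := fun {x y} => hconn.eq_of_energy_eq_zero hσmsymm hσmdiag hσmnn
      (v := slp B dO σ *ᵥ φ) (x := x) (y := y) fun x => by
        rcases hmem x with hx | hx | hx
        · rw [hout _ x hx, mul_zero]
        · rw [hbd x hx, mul_zero]
        · rw [hin φ x hx, mul_zero]
    refine ⟨(slp B dO σ *ᵥ φ) x₀, ?_⟩
    have hSφ : Sop B dO σ *ᵥ φ = (slp B dO σ *ᵥ φ) x₀ • fun _ => (1 : ℝ) := by
      ext x
      rw [Sop_mulVec, Pi.smul_apply, smul_eq_mul, mul_one]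
      exact hconst (Finset.mem_union_left _ x.2) (Finset.mem_union_left _ hx₀)
    rw [← mulVec_smul, ← hSφ, mulVec_mulVec, Matrix.nonsing_inv_mul _ hS, one_mulVec]
  · rintro ⟨c, hφ⟩
    have hu : ∀ x ∈ dO, (slp B dO σ *ᵥ φ) x = c := fun x hx => by
      have h1 := Sop_mulVec B dO σ φ ⟨x, hx⟩
      rw [hφ, mulVec_smul, hSinv, ← hφ] at h1
      simpa using h1.symm
    have hshift : ∀ x, (lap σm *ᵥ fun y => (slp B dO σ *ᵥ φ) y - c) x
        = (lap σm *ᵥ (slp B dO σ *ᵥ φ)) x := fun x => by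
      rw [lap_mulVec hσmdiag, lap_mulVec hσmdiag]
      exact Finset.sum_congr rfl fun y _ => by ring
    have hedge := fun {x y} => eq_of_energy_eq_zero hσmsymm hσmdiag hσmnn
      (v := fun y => (slp B dO σ *ᵥ φ) y - c) (x := x) (y := y) fun x => by
        rw [hshift]
        rcases hmem x with hx | hx | hx
        · rw [hout _ x hx, mul_zero]
        · rw [hu x hx, sub_self, zero_mul]
        · rw [hin φ x hx, mul_zero]
    ext x
    rw [Dadj_mulVec hd2 hsum hpd, ← hshift, lap_mulVec hσmdiag, Finset.sum_eq_zero,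
      Pi.smul_apply, smul_eq_mul]
    · ring
    · intro y _
      rcases (hσmnn x y).eq_or_lt with h0 | h0
      · rw [← h0, zero_mul]
      · rw [hedge h0, sub_self, mul_zero]
  · rw [h, mulVec_zero] at hSinv
    exact zero_ne_one (congrFun hSinv ⟨x₀, hx₀⟩)
end
end

section
/- Let λ ∈ ℝ be an eigenvalue of the Neumann–Poincaré operator D' with λ ≠ 1/2 and λ ≠ −1/2; that is, there exists φ ∈ ℝ^{∂Ω}, φ ≠ 0, with D'φ = λφ. Then −1/2 < λ < 1/2. -/
open Matrix BigOperators

noncomputable section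

variable {V : Type*} [Fintype V] [DecidableEq V]

lemma lap_mulVec_apply (w : V → V → ℝ) (hw : ∀ x, w x x = 0) (u : V → ℝ) (x : V) :
    (lap w *ᵥ u) x = ∑ y, w x y * (u x - u y) := by
  have h : ∀ y, lap w x y * u y
      = (if x = y then (∑ z, w x z) * u y else 0) - w x y * u y := by
    intro y
    by_cases hxy : x = y
    · subst hxy
      simp [lap, hw]
    · simp [lap, hxy]
  simp only [mulVec, dotProduct, h, Finset.sum_sub_distrib, Finset.sum_ite_eq,
    Finset.mem_univ, if_true, mul_sub, Finset.sum_mul]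

lemma dotProduct_lap_mulVec_nonneg (w : V → V → ℝ) (hsymm : ∀ x y, w x y = w y x)
    (hdiag : ∀ x, w x x = 0) (hnn : ∀ x y, 0 ≤ w x y) (u : V → ℝ) :
    0 ≤ u ⬝ᵥ (lap w *ᵥ u) := by
  have h1 : u ⬝ᵥ (lap w *ᵥ u) = ∑ x, ∑ y, u x * (w x y * (u x - u y)) := by
    simp only [dotProduct, lap_mulVec_apply w hdiag, Finset.mul_sum]
  have h2 : u ⬝ᵥ (lap w *ᵥ u) = ∑ x, ∑ y, u y * (w x y * (u y - u x)) := by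
    rw [h1, Finset.sum_comm]
    refine Finset.sum_congr rfl fun x _ => Finset.sum_congr rfl fun y _ => ?_
    rw [hsymm]
  have h3 : u ⬝ᵥ (lap w *ᵥ u) + u ⬝ᵥ (lap w *ᵥ u)
      = ∑ x, ∑ y, w x y * (u x - u y) ^ 2 := by
    nth_rewrite 1 [h1]
    rw [h2, ← Finset.sum_add_distrib]
    refine Finset.sum_congr rfl fun x _ => ?_
    rw [← Finset.sum_add_distrib]
    exact Finset.sum_congr rfl fun y _ => by ring
  have h4 : 0 ≤ ∑ x, ∑ y, w x y * (u x - u y) ^ 2 :=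
    Finset.sum_nonneg fun x _ => Finset.sum_nonneg fun y _ =>
      mul_nonneg (hnn x y) (sq_nonneg _)
  linarith

lemma restr_mulVec_apply (X : Finset V) (f : V → ℝ) (i : {x // x ∈ X}) :
    (restr X *ᵥ f) i = f i := by
  simp [restr, mulVec, dotProduct]

lemma restr_transpose_mulVec_apply_of_notMem (X : Finset V) (g : {x // x ∈ X} → ℝ) {x : V}
    (hx : x ∉ X) : ((restr X)ᵀ *ᵥ g) x = 0 := by
  simp only [mulVec, dotProduct, restr, transpose_apply, of_apply]
  refine Finset.sum_eq_zero fun i _ => ?_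
  have hne : (i : V) ≠ x := fun h => hx (h ▸ i.2)
  rw [if_neg hne, zero_mul]

lemma restr_transpose_mulVec_apply (X : Finset V) (g : {x // x ∈ X} → ℝ) (i : {x // x ∈ X}) :
    ((restr X)ᵀ *ᵥ g) i = g i := by
  simp [restr, mulVec, dotProduct]

/-- A single layer potential vanishes on `B`, has Laplacian given by its density off `B`, and
has positive energy when its density is nonzero. -/
lemma slp_mulVec_properties (B dO : Finset V) (hd : Disjoint B dO) (σ : V → V → ℝ)
    (hpd : (restr Bᶜ * lap σ * (restr Bᶜ)ᵀ).PosDef) (φ : {x // x ∈ dO} → ℝ) :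
    (∀ x ∈ B, (slp B dO σ *ᵥ φ) x = 0) ∧
    (∀ x, x ∉ B → (lap σ *ᵥ (slp B dO σ *ᵥ φ)) x = ((restr dO)ᵀ *ᵥ φ) x) ∧
    (φ ≠ 0 → 0 < (slp B dO σ *ᵥ φ) ⬝ᵥ ((restr dO)ᵀ *ᵥ φ)) := by
  set A := restr Bᶜ * lap σ * (restr Bᶜ)ᵀ with hA
  set f := restr Bᶜ *ᵥ ((restr dO)ᵀ *ᵥ φ) with hf
  have hu : slp B dO σ *ᵥ φ = (restr Bᶜ)ᵀ *ᵥ (A⁻¹ *ᵥ f) := by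
    simp only [slp, green, gamma0, hf, mulVec_mulVec, Matrix.mul_assoc, hA]
  refine ⟨fun x hx => ?_, fun x hx => ?_, fun hφ => ?_⟩
  · rw [hu]
    exact restr_transpose_mulVec_apply_of_notMem _ _ (by simpa using hx)
  · have hAf : A *ᵥ (A⁻¹ *ᵥ f) = f := by
      rw [mulVec_mulVec, mul_nonsing_inv _ ((isUnit_iff_isUnit_det _).1 hpd.isUnit), one_mulVec]
    have := congrFun hAf ⟨x, by simpa using hx⟩
    rw [hA, ← mulVec_mulVec, ← mulVec_mulVec, ← hA, ← hu, hf, restr_mulVec_apply,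
      restr_mulVec_apply] at this
    exact this
  · have hf0 : f ≠ 0 := by
      intro h
      apply hφ
      ext i
      have hi : (i : V) ∈ Bᶜ := by
        simpa using Finset.disjoint_right.1 hd i.2
      have := congrFun h ⟨i, hi⟩
      rw [hf, restr_mulVec_apply] at this
      simpa [restr_transpose_mulVec_apply] using this
    have hpos := hpd.inv.dotProduct_mulVec_pos hf0
    rw [star_trivial] at hpos
    rwa [hu, mulVec_transpose, ← dotProduct_mulVec, ← hf, dotProduct_comm]

theorem stmt_18
    {V : Type*} [Fintype V] [DecidableEq V]
    (B Op dO Om : Finset V)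
    (hBne : B.Nonempty) (hOpne : Op.Nonempty) (hdOne : dO.Nonempty) (hOmne : Om.Nonempty)
    (hd1 : Disjoint B Op) (hd2 : Disjoint B dO) (hd3 : Disjoint B Om)
    (hd4 : Disjoint Op dO) (hd5 : Disjoint Op Om) (hd6 : Disjoint dO Om)
    (hcover : B ∪ Op ∪ dO ∪ Om = Finset.univ)
    (σ σp σm : V → V → ℝ)
    (hσsymm : ∀ x y, σ x y = σ y x) (hσdiag : ∀ x, σ x x = 0)
    (hσnn : ∀ x y, 0 ≤ σ x y)
    (hsepBdO : ∀ x ∈ B, ∀ y ∈ dO, σ x y = 0)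
    (hsepBOm : ∀ x ∈ B, ∀ y ∈ Om, σ x y = 0)
    (hsepOpOm : ∀ x ∈ Op, ∀ y ∈ Om, σ x y = 0)
    (hσpsymm : ∀ x y, σp x y = σp y x) (hσpdiag : ∀ x, σp x x = 0)
    (hσmsymm : ∀ x y, σm x y = σm y x) (hσmdiag : ∀ x, σm x x = 0)
    (hσpnn : ∀ x y, 0 ≤ σp x y) (hσmnn : ∀ x y, 0 ≤ σm x y)
    (hsum : ∀ x y, σp x y + σm x y = σ x y)
    (hp1 : ∀ x y, x ∈ B ∪ Op ∨ y ∈ B ∪ Op → σp x y = σ x y)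
    (hm1 : ∀ x y, x ∈ Om ∨ y ∈ Om → σm x y = σ x y)
    (hpd : (restr Bᶜ * lap σ * (restr Bᶜ)ᵀ).PosDef) :
    ∀ (lam : ℝ) (φ : {x // x ∈ dO} → ℝ), φ ≠ 0 →
      Dadj B dO σ σp σm *ᵥ φ = lam • φ →
      lam ≠ 1/2 → lam ≠ -1/2 →
      -(1/2) < lam ∧ lam < 1/2 := by
  intro lam φ hφ heig hne1 hne2
  obtain ⟨huB, huL, hpos⟩ := slp_mulVec_properties B dO hd2 σ hpd φ
  replace hpos := hpos hφ
  replace heig : (1 / 2 : ℝ) •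
      ((gamma1p dO σp + gamma1m dO σm) *ᵥ (slp B dO σ *ᵥ φ)) = lam • φ := by
    rw [← heig, Dadj, smul_mulVec, mulVec_mulVec]
  set u := slp B dO σ *ᵥ φ with hu
  set g := (restr dO)ᵀ *ᵥ φ with hg
  have hadd : ∀ x, (lap σp *ᵥ u) x + (lap σm *ᵥ u) x = (lap σ *ᵥ u) x := by
    intro x
    rw [lap_mulVec_apply _ hσpdiag, lap_mulVec_apply _ hσmdiag, lap_mulVec_apply _ hσdiag,
      ← Finset.sum_add_distrib]
    exact Finset.sum_congr rfl fun y _ => by rw [← hsum]; ring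
  have hm : ∀ x, u x * (lap σm *ᵥ u) x = (1 / 2 + lam) * (u x * g x) := by
    intro x
    have hx : x ∈ B ∪ Op ∪ dO ∪ Om := hcover ▸ Finset.mem_univ x
    simp only [Finset.mem_union] at hx
    rcases hx with ((hx | hx) | hx) | hx
    · simp [huB x hx]
    · have h0 : (lap σm *ᵥ u) x = 0 := by
        rw [lap_mulVec_apply _ hσmdiag]
        refine Finset.sum_eq_zero fun y _ => ?_
        have := hp1 x y (Or.inl (Finset.mem_union_right _ hx))
        have := hsum x y
        rw [show σm x y = 0 by linarith, zero_mul]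
      have hg0 : g x = 0 :=
        restr_transpose_mulVec_apply_of_notMem _ _ (Finset.disjoint_left.1 hd4 hx)
      rw [h0, hg0]
      ring
    · have he := congrFun heig ⟨x, hx⟩
      have hgx : g x = φ ⟨x, hx⟩ := restr_transpose_mulVec_apply dO φ ⟨x, hx⟩
      simp only [gamma1p, gamma1m, add_mulVec, neg_mulVec, ← mulVec_mulVec, Pi.smul_apply,
        Pi.add_apply, Pi.neg_apply, restr_mulVec_apply, smul_eq_mul, ← hgx] at he
      have h1 := hadd x
      rw [huL x (Finset.disjoint_right.1 hd2 hx)] at h1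
      rw [show (lap σm *ᵥ u) x = (1 / 2 + lam) * g x by linarith]
      ring
    · have h0 : (lap σp *ᵥ u) x = 0 := by
        rw [lap_mulVec_apply _ hσpdiag]
        refine Finset.sum_eq_zero fun y _ => ?_
        have := hm1 x y (Or.inl hx)
        have := hsum x y
        rw [show σp x y = 0 by linarith, zero_mul]
      have hg0 : g x = 0 :=
        restr_transpose_mulVec_apply_of_notMem _ _ (Finset.disjoint_right.1 hd6 hx)
      have h1 := hadd x
      rw [huL x (Finset.disjoint_right.1 hd3 hx), h0, hg0, zero_add] at h1
      rw [h1, hg0]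
      ring
  have hp : ∀ x, u x * (lap σp *ᵥ u) x = (1 / 2 - lam) * (u x * g x) := by
    intro x
    by_cases hx : x ∈ B
    · simp [huB x hx]
    · have h1 := hadd x
      rw [huL x hx] at h1
      rw [eq_sub_of_add_eq h1, mul_sub, hm]
      ring
  have hEm : 0 ≤ (1 / 2 + lam) * (u ⬝ᵥ g) := by
    have := dotProduct_lap_mulVec_nonneg σm hσmsymm hσmdiag hσmnn u
    simpa only [dotProduct, hm, ← Finset.mul_sum] using this
  have hEp : 0 ≤ (1 / 2 - lam) * (u ⬝ᵥ g) := by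
    have := dotProduct_lap_mulVec_nonneg σp hσpsymm hσpdiag hσpnn u
    simpa only [dotProduct, hp, ← Finset.mul_sum] using this
  have h1 : -(1 / 2) ≤ lam := by linarith [nonneg_of_mul_nonneg_left hEm hpos]
  have h2 : lam ≤ 1 / 2 := by linarith [nonneg_of_mul_nonneg_left hEp hpos]
  exact ⟨lt_of_le_of_ne h1 fun h => hne2 (by linarith), lt_of_le_of_ne h2 hne1⟩
end
end
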